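/- arXiv:1509.08571 — 2 statements merged into one kernel-verified Lean document; each statement's English description precedes it below -/
import Mathlib

section
/- For every n ≥ 1, v_sup^s(p, ∅, 𝟙) ≥ inf { V_n(q) : q a probability distribution on 𝒮 }; i.e., Alice can strongly guarantee (up to any ε) the worst-case over priors of the maximin expected average payoff of the n-stage game in which she has no side information and Bob knows the state. -/
open Finset

/-- A behavioral strategy in the `n`-stage repeated game: at stage `i`, given the history of
past actions of both players (only the first `i` coordinates of the supplied sequences matter,
as enforced by `causal`) and the player's side information `si`, it assigns a probability to
each action `x`. -/
structure BehavStrategy (A B SI Act : Type*) [Fintype A] [Fintype B] [Fintype Act] (n : ℕ) where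
  prob : Fin n → (Fin n → A) → (Fin n → B) → SI → Act → ℝ
  nonneg : ∀ i ha hb si x, 0 ≤ prob i ha hb si x
  sum_one : ∀ i ha hb si, ∑ x, prob i ha hb si x = 1
  causal : ∀ (i : Fin n) (ha ha' : Fin n → A) (hb hb' : Fin n → B) (si : SI),
    (∀ j : Fin n, (j : ℕ) < (i : ℕ) → ha j = ha' j) →
    (∀ j : Fin n, (j : ℕ) < (i : ℕ) → hb j = hb' j) →
    prob i ha hb si = prob i ha' hb' si

variable {S SA SB A B : Type*} [Fintype S] [Fintype A] [Fintype B]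

/-- The probability that the state is `s` and the action sequences are `a, b`, under prior `p`,
side-information maps `TA, TB`, and behavioral strategies `α` (Alice) and `β` (Bob). -/
noncomputable def inducedP (p : S → ℝ) (TA : S → SA) (TB : S → SB) {n : ℕ}
    (α : BehavStrategy A B SA A n) (β : BehavStrategy A B SB B n)
    (s : S) (a : Fin n → A) (b : Fin n → B) : ℝ :=
  p s * ∏ i, (α.prob i a b (TA s) (a i) * β.prob i a b (TB s) (b i))

/-- Alice's time-average payoff `σ_n`. -/
noncomputable def avgPay (g : S → A → B → ℝ) {n : ℕ} (s : S) (a : Fin n → A) (b : Fin n → B) : ℝ :=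
  (n : ℝ)⁻¹ * ∑ i, g s (a i) (b i)

open scoped Classical in
/-- `P(σ_n < v)` under the induced distribution. -/
noncomputable def probBelow (g : S → A → B → ℝ) (p : S → ℝ) (TA : S → SA) (TB : S → SB)
    {n : ℕ} (α : BehavStrategy A B SA A n) (β : BehavStrategy A B SB B n) (v : ℝ) : ℝ :=
  ∑ s : S, ∑ a : Fin n → A, ∑ b : Fin n → B,
    if avgPay g s a b < v then inducedP p TA TB α β s a b else 0

/-- Alice strongly guarantees `v`. -/
def StronglyGuarantees (g : S → A → B → ℝ) (p : S → ℝ) (TA : S → SA) (TB : S → SB)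
    (v : ℝ) : Prop :=
  ∀ ε : ℝ, 0 < ε → ∃ N : ℕ, ∀ n : ℕ, N < n → ∃ α : BehavStrategy A B SA A n,
    ∀ β : BehavStrategy A B SB B n, probBelow g p TA TB α β v < ε

/-- Alice weakly guarantees `v`. -/
def WeaklyGuarantees (g : S → A → B → ℝ) (p : S → ℝ) (TA : S → SA) (TB : S → SB)
    (v : ℝ) : Prop :=
  ∀ ε : ℝ, 0 < ε → ∃ N : ℕ, ∀ n : ℕ, N < n → ∀ β : BehavStrategy A B SB B n,
    ∃ α : BehavStrategy A B SA A n, probBelow g p TA TB α β v < ε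

/-- `v_sup^s`, the supremum of strongly guaranteeable values. -/
noncomputable def vsupS (g : S → A → B → ℝ) (p : S → ℝ) (TA : S → SA) (TB : S → SB) : ℝ :=
  sSup {v : ℝ | StronglyGuarantees g p TA TB v}

/-- `v_sup^w`, the supremum of weakly guaranteeable values. -/
noncomputable def vsupW (g : S → A → B → ℝ) (p : S → ℝ) (TA : S → SA) (TB : S → SB) : ℝ :=
  sSup {v : ℝ | WeaklyGuarantees g p TA TB v}

/-- `u(q)`: the value of the one-stage game with averaged payoff table `∑ s, q s • g s`. -/
noncomputable def uVal (g : S → A → B → ℝ) (q : S → ℝ) : ℝ :=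
  ⨆ x : {x : A → ℝ // (∀ a, 0 ≤ x a) ∧ ∑ a, x a = 1},
    ⨅ b : B, ∑ s : S, ∑ a : A, q s * x.1 a * g s a b

/-- Expected time-average payoff `E[σ_n]`. -/
noncomputable def expPay (g : S → A → B → ℝ) (p : S → ℝ) (TA : S → SA) (TB : S → SB)
    {n : ℕ} (α : BehavStrategy A B SA A n) (β : BehavStrategy A B SB B n) : ℝ :=
  ∑ s : S, ∑ a : Fin n → A, ∑ b : Fin n → B,
    inducedP p TA TB α β s a b * avgPay g s a b

/-- `V_n(q)`: the maximin expected average payoff of the `n`-stage game with prior `q`,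
no side information for Alice and full information for Bob. -/
noncomputable def Vn (g : S → A → B → ℝ) (q : S → ℝ) (n : ℕ) : ℝ :=
  ⨆ α : BehavStrategy A B Unit A n, ⨅ β : BehavStrategy A B S B n,
    expPay g q (fun _ => ()) (id : S → S) α β

/-- One-step drift bounds on a potential of the accumulated increments add up to a bound on its
expectation at the end of the game. -/
theorem sum_prod_kernel_mul_potential_le {X E : Type*} [Fintype X] [Nonempty X] [AddCommMonoid E]
    (d : X → E) (C : ℝ) (n : ℕ) (Φ : E → ℝ) (κ : Fin n → (Fin n → X) → X → ℝ)
    (nonneg : ∀ i h x, 0 ≤ κ i h x) (sum_one : ∀ i h, ∑ x, κ i h x = 1)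
    (causal : ∀ i h h', (∀ j, j < i → h j = h' j) → κ i h = κ i h')
    (drift : ∀ i h, ∑ x, κ i h x * Φ ((∑ j, if j < i then d (h j) else 0) + d x) ≤
      Φ (∑ j, if j < i then d (h j) else 0) + C) :
    ∑ h : Fin n → X, (∏ i, κ i h (h i)) * Φ (∑ j, d (h j)) ≤ Φ 0 + n * C := by
  induction n generalizing Φ with
  | zero => simp
  | succ n ih =>
    obtain ⟨x₀⟩ := ‹Nonempty X›
    have first (h : Fin (n + 1) → X) : κ 0 h = κ 0 fun _ => x₀ :=
      causal 0 _ _ fun j hj => absurd hj (Fin.not_lt_zero j)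
    have tail (x : X) : ∑ h : Fin n → X, (∏ i : Fin n, κ i.succ (Fin.cons x h : Fin (n + 1) → X)
        (h i)) * Φ (d x + ∑ j, d (h j)) ≤ Φ (d x) + n * C := by
      have := ih (fun e => Φ (d x + e)) (fun i h => κ i.succ (Fin.cons x h : Fin (n + 1) → X))
        (fun i h y => nonneg _ _ _) (fun i h => sum_one _ _)
        (fun i h h' hh => causal _ _ _ fun j => by
          refine Fin.cases (fun _ => by simp) (fun j hj => ?_) j
          simpa using hh j (Fin.succ_lt_succ_iff.1 hj))
        (fun i h => by
          have := drift i.succ (Fin.cons x h : Fin (n + 1) → X)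
          simpa [Fin.sum_univ_succ, add_assoc] using this)
      simpa using this
    have hd := drift 0 fun _ => x₀
    simp only [Fin.not_lt_zero, if_false, Finset.sum_const_zero, zero_add] at hd
    rw [← (Fin.consEquiv fun _ => X).sum_comp, Fintype.sum_prod_type]
    calc _ = ∑ x, κ 0 (fun _ => x₀) x * ∑ h : Fin n → X,
          (∏ i : Fin n, κ i.succ (Fin.cons x h : Fin (n + 1) → X) (h i)) *
            Φ (d x + ∑ j, d (h j)) := by
          refine Finset.sum_congr rfl fun x _ => ?_
          rw [Finset.mul_sum]
          refine Finset.sum_congr rfl fun h _ => ?_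
          simp [Fin.prod_univ_succ, Fin.sum_univ_succ, Fin.consEquiv, first (Fin.cons x h),
            mul_assoc]
      _ ≤ ∑ x, κ 0 (fun _ => x₀) x * (Φ (d x) + n * C) :=
          Finset.sum_le_sum fun x _ => mul_le_mul_of_nonneg_left (tail x) (nonneg _ _ _)
      _ = ∑ x, κ 0 (fun _ => x₀) x * Φ (d x) + n * C := by
          simp only [mul_add, Finset.sum_add_distrib, ← Finset.sum_mul, sum_one, one_mul]
      _ ≤ _ := by push_cast; linarith

/-- The probability of the action sequences `a, b` in state `s`. -/
noncomputable def playProb {n : ℕ} (α : BehavStrategy A B Unit A n) (β : BehavStrategy A B S B n)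
    (s : S) (a : Fin n → A) (b : Fin n → B) : ℝ :=
  ∏ i, (α.prob i a b () (a i) * β.prob i a b s (b i))

theorem playProb_nonneg {S A B : Type*} [Fintype A] [Fintype B] {n : ℕ}
    (α : BehavStrategy A B Unit A n) (β : BehavStrategy A B S B n)
    (s : S) (a : Fin n → A) (b : Fin n → B) : 0 ≤ playProb α β s a b :=
  Finset.prod_nonneg fun _ _ => mul_nonneg (α.nonneg _ _ _ _ _) (β.nonneg _ _ _ _ _)

/-- `sum_prod_kernel_mul_potential_le` for the play of a fixed state. -/
theorem sum_playProb_mul_potential_le {S A B : Type*} [Fintype A] [Fintype B]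
    [Nonempty A] [Nonempty B] {E : Type*} [AddCommMonoid E]
    (d : A → B → E) (C : ℝ) (Φ : E → ℝ) {n : ℕ} (α : BehavStrategy A B Unit A n)
    (β : BehavStrategy A B S B n) (s : S)
    (drift : ∀ i (a : Fin n → A) (b : Fin n → B),
      ∑ x, ∑ y, α.prob i a b () x * β.prob i a b s y *
        Φ ((∑ j, if j < i then d (a j) (b j) else 0) + d x y) ≤
      Φ (∑ j, if j < i then d (a j) (b j) else 0) + C) :
    ∑ a, ∑ b, playProb α β s a b * Φ (∑ j, d (a j) (b j)) ≤ Φ 0 + n * C := by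
  have := sum_prod_kernel_mul_potential_le (X := A × B) (fun x => d x.1 x.2) C n Φ
    (fun i h x => α.prob i (fun j => (h j).1) (fun j => (h j).2) () x.1 *
      β.prob i (fun j => (h j).1) (fun j => (h j).2) s x.2)
    (fun i h x => mul_nonneg (α.nonneg _ _ _ _ _) (β.nonneg _ _ _ _ _))
    (fun i h => by
      simp only [Fintype.sum_prod_type, ← Finset.mul_sum, β.sum_one, mul_one, α.sum_one])
    (fun i h h' hh => by
      ext x
      rw [α.causal i _ (fun j => (h' j).1) _ (fun j => (h' j).2) ()
          (fun j hj => by rw [hh j hj]) (fun j hj => by rw [hh j hj]),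
        β.causal i _ (fun j => (h' j).1) _ (fun j => (h' j).2) s
          (fun j hj => by rw [hh j hj]) (fun j hj => by rw [hh j hj])])
    (fun i h => by
      rw [Fintype.sum_prod_type]
      exact drift i (fun j => (h j).1) (fun j => (h j).2))
  rwa [← (Equiv.arrowProdEquivProdArrow (Fin n) (fun _ => A) (fun _ => B)).symm.sum_comp,
    Fintype.sum_prod_type] at this

theorem sum_playProb {S A B : Type*} [Fintype A] [Fintype B] [Nonempty A] [Nonempty B]
    {n : ℕ} (α : BehavStrategy A B Unit A n) (β : BehavStrategy A B S B n) (s : S) :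
    ∑ a, ∑ b, playProb α β s a b = 1 := by
  have key (c : ℝ) := sum_playProb_mul_potential_le (fun _ _ => (0 : ℝ)) 0 (fun _ => c) α β s
    (fun i a b => by
      simp only [← Finset.sum_mul, ← Finset.mul_sum, β.sum_one, mul_one, α.sum_one]; simp)
  have h₁ := key 1
  have h₂ := key (-1)
  simp only [mul_one, mul_neg, Finset.sum_neg_distrib, mul_zero, add_zero] at h₁ h₂
  linarith

theorem inducedP_eq {S A B : Type*} [Fintype A] [Fintype B] {n : ℕ} (p : S → ℝ)
    (α : BehavStrategy A B Unit A n)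
    (β : BehavStrategy A B S B n) (s : S) (a : Fin n → A) (b : Fin n → B) :
    inducedP p (fun _ : S => ()) (id : S → S) α β s a b = p s * playProb α β s a b := rfl

theorem exists_forall_abs_le (g : S → A → B → ℝ) : ∃ M : ℝ, ∀ s a b, |g s a b| ≤ M := by
  refine ⟨∑ s, ∑ a, ∑ b, |g s a b|, fun s a b => ?_⟩
  calc |g s a b| ≤ ∑ b, |g s a b| :=
        Finset.single_le_sum (f := fun b => |g s a b|) (fun _ _ => abs_nonneg _) (mem_univ b)
    _ ≤ ∑ a, ∑ b, |g s a b| :=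
        Finset.single_le_sum (f := fun a => ∑ b, |g s a b|) (fun _ _ => by positivity) (mem_univ a)
    _ ≤ _ :=
        Finset.single_le_sum (f := fun s => ∑ a, ∑ b, |g s a b|) (fun _ _ => by positivity)
          (mem_univ s)

theorem abs_avgPay_le {S A B : Type*} {g : S → A → B → ℝ} {M : ℝ}
    (hM : ∀ s a b, |g s a b| ≤ M) {n : ℕ} (hn : 1 ≤ n) (s : S) (a : Fin n → A) (b : Fin n → B) : |avgPay g s a b| ≤ M := by
  have hn' : (0 : ℝ) < n := by exact_mod_cast hn
  rw [avgPay, abs_mul, abs_of_nonneg (inv_nonneg.2 hn'.le), inv_mul_le_iff₀ hn']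
  calc _ ≤ ∑ i, |g s (a i) (b i)| := Finset.abs_sum_le_sum_abs _ _
    _ ≤ ∑ _i : Fin n, M := Finset.sum_le_sum fun i _ => hM _ _ _
    _ = _ := by simp

/-- The strategy that plays the action `f i a b` at stage `i`. -/
noncomputable def BehavStrategy.pure {T Act : Type*} [Fintype Act] [DecidableEq Act] {n : ℕ}
    (f : Fin n → (Fin n → A) → (Fin n → B) → Act)
    (causal : ∀ (i : Fin n) (a a' : Fin n → A) (b b' : Fin n → B),
      (∀ j : Fin n, (j : ℕ) < (i : ℕ) → a j = a' j) →
      (∀ j : Fin n, (j : ℕ) < (i : ℕ) → b j = b' j) → f i a b = f i a' b') :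
    BehavStrategy A B T Act n where
  prob i a b _ x := if x = f i a b then 1 else 0
  nonneg i a b _ x := by split_ifs <;> norm_num
  sum_one i a b _ := by simp
  causal i a a' b b' _ h h' := by simp only [causal i a a' b b' h h']

instance {T Act : Type*} [Fintype Act] [Nonempty Act] {n : ℕ} :
    Nonempty (BehavStrategy A B T Act n) := by
  classical
  exact ⟨.pure (fun _ _ _ => Classical.arbitrary Act) fun _ _ _ _ _ _ _ => rfl⟩

theorem neg_le_expPay [Nonempty A] [Nonempty B] {g : S → A → B → ℝ} {M : ℝ}
    (hM : ∀ s a b, |g s a b| ≤ M) {q : S → ℝ} (hq : ∀ s, 0 ≤ q s) (hq1 : ∑ s, q s = 1) {n : ℕ}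
    (hn : 1 ≤ n) (α : BehavStrategy A B Unit A n) (β : BehavStrategy A B S B n) :
    -M ≤ expPay g q (fun _ => ()) (id : S → S) α β := by
  calc -M = ∑ s, q s * ((∑ a, ∑ b, playProb α β s a b) * -M) := by
        simp only [sum_playProb, ← Finset.sum_mul, hq1, one_mul]
    _ = ∑ s, ∑ a, ∑ b, q s * playProb α β s a b * -M := by
        simp only [Finset.sum_mul, Finset.mul_sum, mul_assoc]
    _ ≤ _ := by
        unfold expPay
        refine Finset.sum_le_sum fun s _ => Finset.sum_le_sum fun a _ =>
          Finset.sum_le_sum fun b _ => ?_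
        rw [inducedP_eq]
        exact mul_le_mul_of_nonneg_left (neg_le_of_abs_le (abs_avgPay_le hM hn s a b))
          (mul_nonneg (hq s) (playProb_nonneg α β s a b))

theorem bddAbove_range_iInf_average [Nonempty B] (g : S → A → B → ℝ) {q : S → ℝ}
    (hq : ∀ s, 0 ≤ q s) (hq1 : ∑ s, q s = 1) :
    BddAbove (Set.range fun x : {x : A → ℝ // (∀ a, 0 ≤ x a) ∧ ∑ a, x a = 1} =>
      ⨅ b : B, ∑ s : S, ∑ a : A, q s * x.1 a * g s a b) := by
  obtain ⟨M, hM⟩ := exists_forall_abs_le g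
  refine ⟨M, ?_⟩
  rintro _ ⟨x, rfl⟩
  refine (ciInf_le (Set.finite_range _).bddBelow (Classical.arbitrary B)).trans ?_
  calc _ ≤ ∑ s, ∑ a, q s * x.1 a * M := by
        gcongr with s _ a _
        · exact mul_nonneg (hq s) (x.2.1 a)
        · exact le_of_abs_le (hM _ _ _)
    _ = M := by simp only [← Finset.sum_mul, ← Finset.mul_sum, x.2.2, mul_one, hq1, one_mul]

/-- Against a known strategy of Alice, an uninformed Bob can reply so as to pay at most `u(q)`. -/
theorem exists_expPay_le_uVal [Nonempty A] [Nonempty B] (g : S → A → B → ℝ) {q : S → ℝ}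
    (hq : ∀ s, 0 ≤ q s) (hq1 : ∑ s, q s = 1) {n : ℕ} (hn : 1 ≤ n)
    (α : BehavStrategy A B Unit A n) :
    ∃ β : BehavStrategy A B S B n, expPay g q (fun _ => ()) (id : S → S) α β ≤ uVal g q := by
  classical
  have reply (x : A → ℝ) : ∃ b, ∀ b', ∑ s : S, ∑ a : A, q s * x a * g s a b ≤
      ∑ s : S, ∑ a : A, q s * x a * g s a b' := Finite.exists_min _
  choose r hr using reply
  let β : BehavStrategy A B S B n := .pure (fun i a b => r (α.prob i a b ()))
    fun i a a' b b' h h' => by rw [α.causal i a a' b b' () h h']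
  refine ⟨β, ?_⟩
  have hβ (s s' : S) (a : Fin n → A) (b : Fin n → B) : playProb α β s a b = playProb α β s' a b :=
    rfl
  have hn' : (0 : ℝ) < n := by exact_mod_cast hn
  have hS : Nonempty S := by
    by_contra h
    rw [not_nonempty_iff] at h
    simp at hq1
  obtain ⟨s₀⟩ := hS
  have key := sum_playProb_mul_potential_le (fun a b => ∑ s, q s * g s a b) (uVal g q) id α β s₀
    (fun i a b => by
      have hle : ∑ s, ∑ x, q s * α.prob i a b () x * g s x (r (α.prob i a b ())) ≤ uVal g q := by
        refine le_trans ?_ (le_ciSup (bddAbove_range_iInf_average g hq hq1)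
          ⟨α.prob i a b (), α.nonneg i a b (), α.sum_one i a b ()⟩)
        exact le_ciInf (hr _)
      have swap : ∑ x, ∑ y, α.prob i a b () x * β.prob i a b s₀ y * ∑ s, q s * g s x y =
          ∑ s, ∑ x, q s * α.prob i a b () x * g s x (r (α.prob i a b ())) := by
        rw [Finset.sum_comm (s := (univ : Finset S)) (t := (univ : Finset A))]
        refine Finset.sum_congr rfl fun x _ => ?_
        simp only [β, BehavStrategy.pure, mul_ite, mul_one, mul_zero, ite_mul, zero_mul,
          Finset.sum_ite_eq', mem_univ, if_true]
        rw [Finset.mul_sum]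
        exact Finset.sum_congr rfl fun s _ => by ring
      simp only [id, mul_add, Finset.sum_add_distrib, swap]
      refine add_le_add (le_of_eq ?_) hle
      simp only [← Finset.sum_mul, ← Finset.mul_sum, β.sum_one, mul_one, α.sum_one, one_mul])
  simp only [id, zero_add] at key
  calc expPay g q (fun _ => ()) (id : S → S) α β
      = ∑ s, ∑ a, ∑ b, (n : ℝ)⁻¹ * (playProb α β s₀ a b * (q s * ∑ j, g s (a j) (b j))) := by
        unfold expPay
        refine Finset.sum_congr rfl fun s _ => Finset.sum_congr rfl fun a _ =>
          Finset.sum_congr rfl fun b _ => ?_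
        rw [inducedP_eq, hβ s s₀, avgPay]
        ring
    _ = (n : ℝ)⁻¹ * ∑ a, ∑ b, playProb α β s₀ a b * ∑ j, ∑ s, q s * g s (a j) (b j) := by
        rw [Finset.sum_comm, Finset.mul_sum]
        refine Finset.sum_congr rfl fun a _ => ?_
        rw [Finset.sum_comm, Finset.mul_sum]
        refine Finset.sum_congr rfl fun b _ => ?_
        rw [Finset.sum_comm (s := (univ : Finset (Fin n))) (t := (univ : Finset S))]
        simp only [Finset.mul_sum]
    _ ≤ (n : ℝ)⁻¹ * (n * uVal g q) := by gcongr
    _ = uVal g q := by field_simp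

theorem iInf_expPay_le_uVal [Nonempty A] [Nonempty B] (g : S → A → B → ℝ) {q : S → ℝ}
    (hq : ∀ s, 0 ≤ q s) (hq1 : ∑ s, q s = 1) {n : ℕ} (hn : 1 ≤ n)
    (α : BehavStrategy A B Unit A n) :
    ⨅ β : BehavStrategy A B S B n, expPay g q (fun _ => ()) (id : S → S) α β ≤ uVal g q := by
  obtain ⟨M, hM⟩ := exists_forall_abs_le g
  obtain ⟨β, hβ⟩ := exists_expPay_le_uVal g hq hq1 hn α
  exact ciInf_le_of_le ⟨-M, by rintro _ ⟨β, rfl⟩; exact neg_le_expPay hM hq hq1 hn α β⟩ β hβ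

theorem Vn_le_uVal [Nonempty A] [Nonempty B] (g : S → A → B → ℝ) {q : S → ℝ}
    (hq : ∀ s, 0 ≤ q s) (hq1 : ∑ s, q s = 1) {n : ℕ} (hn : 1 ≤ n) : Vn g q n ≤ uVal g q :=
  ciSup_le fun α => iInf_expPay_le_uVal g hq hq1 hn α

theorem bddBelow_range_Vn [Nonempty A] [Nonempty B] (g : S → A → B → ℝ) {n : ℕ} (hn : 1 ≤ n) :
    BddBelow (Set.range fun q : {q : S → ℝ // (∀ s, 0 ≤ q s) ∧ ∑ s, q s = 1} => Vn g q.1 n) := by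
  obtain ⟨M, hM⟩ := exists_forall_abs_le g
  refine ⟨-M, ?_⟩
  rintro _ ⟨q, rfl⟩
  refine le_trans ?_ (le_ciSup (f := fun α : BehavStrategy A B Unit A n =>
    ⨅ β : BehavStrategy A B S B n, expPay g q.1 (fun _ => ()) (id : S → S) α β)
    ⟨uVal g q.1, ?_⟩ (Classical.arbitrary _))
  · exact le_ciInf fun β => neg_le_expPay hM q.2.1 q.2.2 hn _ β
  · rintro _ ⟨α, rfl⟩
    exact iInf_expPay_le_uVal g q.2.1 q.2.2 hn α

theorem bddAbove_stronglyGuarantees [Nonempty A] [Nonempty B] (g : S → A → B → ℝ) {p : S → ℝ}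
    (hp1 : ∑ s, p s = 1) :
    BddAbove {v : ℝ | StronglyGuarantees g p (fun _ : S => ()) (id : S → S) v} := by
  obtain ⟨M, hM⟩ := exists_forall_abs_le g
  refine ⟨M, fun v hv => ?_⟩
  by_contra! hlt
  obtain ⟨N, hN⟩ := hv 1 one_pos
  obtain ⟨α, hα⟩ := hN (N + 1) N.lt_succ_self
  have h := hα (Classical.arbitrary _)
  have hlt' (s : S) (a : Fin (N + 1) → A) (b : Fin (N + 1) → B) : avgPay g s a b < v :=
    (le_of_abs_le (abs_avgPay_le hM (by omega) s a b)).trans_lt hlt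
  simp only [probBelow, hlt', if_true, inducedP_eq, ← Finset.mul_sum, sum_playProb, mul_one,
    hp1] at h
  exact lt_irrefl _ h

/-- If `w < u(q)` for every prior `q`, every nonnegative weighting of the states admits a mixed
action of Alice whose weighted payoff is at least `w`. -/
theorem exists_mixed_weighted_sub_nonpos [Nonempty A] (g : S → A → B → ℝ) {w : ℝ}
    (hw : ∀ q : S → ℝ, (∀ s, 0 ≤ q s) → ∑ s, q s = 1 → w < uVal g q) (D : S → ℝ)
    (hD : ∀ s, 0 ≤ D s) :
    ∃ x : A → ℝ, (∀ a, 0 ≤ x a) ∧ ∑ a, x a = 1 ∧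
      ∀ b, ∑ a, x a * ∑ s, D s * (w - g s a b) ≤ 0 := by
  classical
  have hpt : (∀ a, 0 ≤ (Pi.single (Classical.arbitrary A) 1 : A → ℝ) a) ∧
      ∑ a, (Pi.single (Classical.arbitrary A) 1 : A → ℝ) a = 1 :=
    ⟨fun a => by by_cases h : a = Classical.arbitrary A <;> simp [h], by simp⟩
  rcases (Finset.sum_nonneg fun s _ => hD s : (0 : ℝ) ≤ ∑ s, D s).eq_or_lt with h0 | h0
  · have hz (s : S) : D s = 0 :=
      (Finset.sum_eq_zero_iff_of_nonneg fun s _ => hD s).1 h0.symm s (mem_univ s)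
    exact ⟨_, hpt.1, hpt.2, by simp [hz]⟩
  · have : Nonempty {x : A → ℝ // (∀ a, 0 ≤ x a) ∧ ∑ a, x a = 1} := ⟨⟨_, hpt⟩⟩
    obtain ⟨x, hx⟩ := exists_lt_of_lt_ciSup (hw (fun s => D s / ∑ s, D s)
      (fun s => div_nonneg (hD s) h0.le) (by rw [← Finset.sum_div, div_self h0.ne']))
    refine ⟨x.1, x.2.1, x.2.2, fun b => ?_⟩
    have hb := hx.le.trans (ciInf_le (Set.finite_range _).bddBelow b)
    have h₁ : ∑ s, ∑ a, D s / (∑ s, D s) * x.1 a * g s a b =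
        (∑ a, x.1 a * ∑ s, D s * g s a b) / ∑ s, D s := by
      rw [Finset.sum_comm, Finset.sum_div]
      refine Finset.sum_congr rfl fun a _ => ?_
      rw [Finset.mul_sum, Finset.sum_div]
      exact Finset.sum_congr rfl fun s _ => by ring
    rw [h₁, le_div_iff₀ h0] at hb
    simp only [mul_sub, Finset.sum_sub_distrib, ← Finset.sum_mul, x.2.2, one_mul]
    linarith

/-- One step of the squared positive part. -/
theorem sq_max_add_le (y e : ℝ) : max (y + e) 0 ^ 2 ≤ max y 0 ^ 2 + 2 * (max y 0 * e) + e ^ 2 := by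
  rcases le_total y 0 with h | h <;> rcases le_total (y + e) 0 with h' | h' <;>
    simp only [max_eq_left, max_eq_right, h, h'] <;> nlinarith [sq_nonneg (y + e)]

/-- Blackwell's approachability strategy: Alice can keep the expected squared positive part of the
accumulated shortfall from `w`, over all states simultaneously, of linear order. -/
theorem exists_forall_sum_playProb_mul_sq_shortfall_le [Nonempty A] [Nonempty B]
    (g : S → A → B → ℝ) {w : ℝ}
    (hw : ∀ q : S → ℝ, (∀ s, 0 ≤ q s) → ∑ s, q s = 1 → w < uVal g q) :
    ∃ C : ℝ, ∀ n, ∃ α : BehavStrategy A B Unit A n, ∀ (β : BehavStrategy A B S B n) (t : S),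
      ∑ a, ∑ b, playProb α β t a b * ∑ s, max (∑ j, (w - g s (a j) (b j))) 0 ^ 2 ≤ n * C := by
  obtain ⟨M, hM⟩ := exists_forall_abs_le (fun (s : S) (a : A) (b : B) => w - g s a b)
  choose x hx0 hx1 hx using fun y : S → ℝ =>
    exists_mixed_weighted_sub_nonpos g hw (fun s => max (y s) 0) fun s => le_max_right _ _
  refine ⟨∑ _s : S, M ^ 2, fun n => ?_⟩
  let d : A → B → S → ℝ := fun a b s => w - g s a b
  let α : BehavStrategy A B Unit A n :=
    { prob := fun i a b _ => x (∑ j, if j < i then d (a j) (b j) else 0)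
      nonneg := fun i a b _ => hx0 _
      sum_one := fun i a b _ => hx1 _
      causal := fun i a a' b b' _ h h' => by
        congr 1
        refine Finset.sum_congr rfl fun j _ => ?_
        split_ifs with hj
        · rw [h j hj, h' j hj]
        · rfl }
  refine ⟨α, fun β t => ?_⟩
  have := sum_playProb_mul_potential_le d (∑ _s : S, M ^ 2) (fun y => ∑ s, max (y s) 0 ^ 2) α β t
    (fun i a b => by
      set y := ∑ j, if j < i then d (a j) (b j) else 0 with hy
      have step (a' : A) (b' : B) : ∑ s, max ((y + d a' b') s) 0 ^ 2 ≤
          (∑ s, max (y s) 0 ^ 2 + ∑ _s : S, M ^ 2) + 2 * ∑ s, max (y s) 0 * (w - g s a' b') := by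
        rw [Finset.mul_sum, ← Finset.sum_add_distrib, ← Finset.sum_add_distrib]
        refine Finset.sum_le_sum fun s _ => ?_
        have h₁ := sq_max_add_le (y s) (w - g s a' b')
        have h₂ := sq_le_sq' (neg_le_of_abs_le (hM s a' b')) (le_of_abs_le (hM s a' b'))
        simp only [Pi.add_apply, d]
        linarith
      have weighted : ∑ a', ∑ b', α.prob i a b () a' * β.prob i a b t b' *
          ∑ s, max (y s) 0 * (w - g s a' b') ≤ 0 := by
        rw [Finset.sum_comm]
        refine Finset.sum_nonpos fun b' _ => ?_
        calc _ = β.prob i a b t b' * ∑ a', x y a' * ∑ s, max (y s) 0 * (w - g s a' b') := by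
              rw [Finset.mul_sum]
              exact Finset.sum_congr rfl fun a' _ => by simp only [α, ← hy]; ring
          _ ≤ 0 := mul_nonpos_of_nonneg_of_nonpos (β.nonneg _ _ _ _ _) (hx y b')
      calc _ ≤ ∑ a', ∑ b', α.prob i a b () a' * β.prob i a b t b' *
            ((∑ s, max (y s) 0 ^ 2 + ∑ _s : S, M ^ 2) +
              2 * ∑ s, max (y s) 0 * (w - g s a' b')) := by
            gcongr with a' _ b' _
            · exact mul_nonneg (α.nonneg _ _ _ _ _) (β.nonneg _ _ _ _ _)
            · exact step a' b'
        _ = (∑ s, max (y s) 0 ^ 2 + ∑ _s : S, M ^ 2) +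
            2 * ∑ a', ∑ b', α.prob i a b () a' * β.prob i a b t b' *
              ∑ s, max (y s) 0 * (w - g s a' b') := by
            generalize ∑ s, max (y s) 0 ^ 2 + ∑ _s : S, M ^ 2 = K
            simp only [mul_add, Finset.sum_add_distrib]
            congr 1
            · simp only [← Finset.sum_mul, ← Finset.mul_sum, β.sum_one, mul_one, α.sum_one,
                one_mul]
            · simp only [mul_left_comm _ (2 : ℝ), ← Finset.mul_sum]
        _ ≤ _ := by linarith)
  simpa [d] using this

theorem stronglyGuarantees_of_lt [Nonempty A] [Nonempty B] (g : S → A → B → ℝ) {p : S → ℝ}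
    (hp : ∀ s, 0 ≤ p s) (hp1 : ∑ s, p s = 1) {v w : ℝ} (hvw : v < w)
    (hw : ∀ q : S → ℝ, (∀ s, 0 ≤ q s) → ∑ s, q s = 1 → w < uVal g q) :
    StronglyGuarantees g p (fun _ : S => ()) (id : S → S) v := by
  obtain ⟨C, hC⟩ := exists_forall_sum_playProb_mul_sq_shortfall_le g hw
  intro ε hε
  obtain ⟨N, hN⟩ := exists_nat_gt (C / ((w - v) ^ 2 * ε))
  refine ⟨N, fun n hn => ?_⟩
  obtain ⟨α, hα⟩ := hC n
  refine ⟨α, fun β => ?_⟩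
  have hδ : 0 < w - v := sub_pos.2 hvw
  have hn' : (0 : ℝ) < n := by exact_mod_cast (Nat.zero_le N).trans_lt hn
  have hNn : (N : ℝ) < n := by exact_mod_cast hn
  have markov (s : S) (a : Fin n → A) (b : Fin n → B) (h : avgPay g s a b < v) :
      (n * (w - v)) ^ 2 ≤ ∑ s, max (∑ j, (w - g s (a j) (b j))) 0 ^ 2 := by
    rw [avgPay, inv_mul_lt_iff₀ hn'] at h
    have h₁ : n * (w - v) ≤ max (∑ j, (w - g s (a j) (b j))) 0 := by
      refine le_trans ?_ (le_max_left _ _)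
      simp only [Finset.sum_sub_distrib, Finset.sum_const, Finset.card_univ, Fintype.card_fin,
        nsmul_eq_mul]
      linarith
    refine (pow_le_pow_left₀ (by positivity) h₁ 2).trans ?_
    exact Finset.single_le_sum (f := fun s => max (∑ j, (w - g s (a j) (b j))) 0 ^ 2)
      (fun _ _ => sq_nonneg _) (mem_univ s)
  calc probBelow g p (fun _ : S => ()) (id : S → S) α β v
      ≤ ∑ t, ∑ a, ∑ b, p t * (playProb α β t a b *
          (∑ s, max (∑ j, (w - g s (a j) (b j))) 0 ^ 2)) / (n * (w - v)) ^ 2 := by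
        unfold probBelow
        gcongr with t _ a _ b _
        have h0 := mul_nonneg (hp t) (playProb_nonneg α β t a b)
        rw [le_div_iff₀ (by positivity), inducedP_eq, ← mul_assoc]
        split_ifs with h
        · exact mul_le_mul_of_nonneg_left (markov t a b h) h0
        · rw [zero_mul]
          exact mul_nonneg h0 (Finset.sum_nonneg fun _ _ => sq_nonneg _)
    _ = ∑ t, p t * (∑ a, ∑ b, playProb α β t a b *
          (∑ s, max (∑ j, (w - g s (a j) (b j))) 0 ^ 2)) / (n * (w - v)) ^ 2 := by
        simp only [← Finset.sum_div, ← Finset.mul_sum]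
    _ ≤ ∑ t, p t * (n * C) / (n * (w - v)) ^ 2 := by
        gcongr with t _
        · exact hp t
        · exact hα β t
    _ = C / ((w - v) ^ 2 * n) := by
        rw [← Finset.sum_div, ← Finset.sum_mul, hp1]
        field_simp
    _ < ε := by
        rw [div_lt_iff₀ (by positivity)] at hN ⊢
        nlinarith [mul_pos (pow_pos hδ 2) hε]

/-- For every `n ≥ 1`,
`v_sup^s(p, ∅, 𝟙) ≥ inf { V_n(q) : q a probability distribution on 𝒮 }`. -/
theorem stmt5 {S A B : Type*} [Fintype S] [Fintype A] [Fintype B]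
    [Nonempty S] [Nonempty A] [Nonempty B]
    (g : S → A → B → ℝ) (p : S → ℝ) (hp : ∀ s, 0 < p s) (hp1 : ∑ s, p s = 1)
    (n : ℕ) (hn : 1 ≤ n) :
    (⨅ q : {q : S → ℝ // (∀ s, 0 ≤ q s) ∧ ∑ s, q s = 1}, Vn g q.1 n) ≤
      vsupS g p (fun _ : S => ()) (id : S → S) := by
  refine le_of_forall_lt fun c hc => ?_
  obtain ⟨v, hcv, hv⟩ := exists_between hc
  obtain ⟨w, hvw, hw⟩ := exists_between hv
  refine hcv.trans_le (le_csSup (bddAbove_stronglyGuarantees g hp1)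
    (stronglyGuarantees_of_lt g (fun s => (hp s).le) hp1 hvw fun q hq hq1 => ?_))
  exact hw.trans_le ((ciInf_le (bddBelow_range_Vn g hn) ⟨q, hq, hq1⟩).trans
    (Vn_le_uVal g hq hq1 hn))
end

section
/- v_sup^w(p, ∅, 𝟙) ≤ inf { u(q) : q a probability distribution on 𝒮 }; i.e., when Alice has no side information and Bob knows the state exactly, Alice cannot weakly guarantee any value above the minimum over priors q of the value u(q) of the one-stage averaged game. -/
open Finset

variable {S SA SB A B : Type*} [Fintype S] [Fintype A] [Fintype B]

/-- **Von Neumann's minimax theorem** for a finite matrix game: the minimizer has a mixed action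
`y` and the maximizer a mixed action `x` such that every reply to `y` pays at most what `x`
secures. -/
theorem exists_mixed_saddlePoint {A B : Type*} [Fintype A] [Fintype B] [Nonempty A] [Nonempty B]
    (G : A → B → ℝ) :
    ∃ y ∈ stdSimplex ℝ B, ∃ x ∈ stdSimplex ℝ A,
      ∀ a b, ∑ b', y b' * G a b' ≤ ∑ a', x a' * G a' b := by
  classical
  let L : (B → ℝ) →ₗ[ℝ] (A → ℝ) →ₗ[ℝ] ℝ :=
    LinearMap.mk₂ ℝ (fun y x => ∑ a, ∑ b, y b * x a * G a b)
      (by intros; simp [add_mul, sum_add_distrib])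
      (by intros; simp [mul_sum, mul_assoc])
      (by intros; simp [add_mul, mul_add, sum_add_distrib])
      (by intros; simp only [mul_sum, Pi.smul_apply, smul_eq_mul]; congr! 2; ring)
  have hL (y x) : L y x = ∑ a, ∑ b, y b * x a * G a b := rfl
  obtain ⟨y, hy, x, hx, h⟩ := Sion.exists_isSaddlePointOn
    (X := stdSimplex ℝ B) (Y := stdSimplex ℝ A) (f := fun y x => L y x)
    ⟨_, single_mem_stdSimplex ℝ (Classical.arbitrary B)⟩ (convex_stdSimplex ℝ B)
    (isCompact_stdSimplex ℝ B)
    (fun x _ => (L.flip x).continuous_of_finiteDimensional.lowerSemicontinuous.lowerSemicontinuousOn _)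
    (fun x _ => ((L.flip x).convexOn (convex_stdSimplex ℝ B)).quasiconvexOn)
    (convex_stdSimplex ℝ A)
    ⟨_, single_mem_stdSimplex ℝ (Classical.arbitrary A)⟩
    (isCompact_stdSimplex ℝ A)
    (fun y _ => (L y).continuous_of_finiteDimensional.upperSemicontinuous.upperSemicontinuousOn _)
    (fun y _ => ((L y).concaveOn (convex_stdSimplex ℝ A)).quasiconcaveOn)
  refine ⟨y, hy, x, hx, fun a b => ?_⟩
  simpa [hL, Pi.single_apply, ite_mul, mul_ite] using
    h _ (single_mem_stdSimplex ℝ b) _ (single_mem_stdSimplex ℝ a)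

/-- In a finite game, the minimizer has a mixed action holding every reply to the value `u(q)`. -/
theorem exists_mixed_le_uVal {S A B : Type*} [Fintype S] [Fintype A] [Fintype B] [Nonempty A]
    [Nonempty B] (g : S → A → B → ℝ) (q : S → ℝ) :
    ∃ y ∈ stdSimplex ℝ B, ∀ a, ∑ b, y b * ∑ s, q s * g s a b ≤ uVal g q := by
  obtain ⟨y, hy, x, hx, h⟩ := exists_mixed_saddlePoint fun a b => ∑ s, q s * g s a b
  have hpay (x : A → ℝ) (b : B) : ∑ s, ∑ a, q s * x a * g s a b =
      ∑ a, x a * ∑ s, q s * g s a b := by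
    rw [sum_comm]
    simp only [mul_sum]
    congr! 2
    ring
  refine ⟨y, hy, fun a => le_trans (le_ciInf fun b => ?_)
    (le_ciSup (f := fun x : {x : A → ℝ // (∀ a, 0 ≤ x a) ∧ ∑ a, x a = 1} =>
      ⨅ b, ∑ s, ∑ a, q s * x.1 a * g s a b) ?_ ⟨x, hx⟩)⟩
  · simpa only [hpay] using h a b
  · let b₀ := Classical.arbitrary B
    refine ⟨∑ a, |∑ s, q s * g s a b₀|, ?_⟩
    rintro _ ⟨z, rfl⟩
    refine (ciInf_le (Set.finite_range _).bddBelow b₀).trans ?_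
    rw [hpay]
    refine sum_le_sum fun a _ => ?_
    have hz1 : z.1 a ≤ 1 := 
      (single_le_sum (fun a _ => z.2.1 a) (mem_univ a)).trans_eq z.2.2
    calc z.1 a * ∑ s, q s * g s a b₀ ≤ z.1 a * |∑ s, q s * g s a b₀| :=
          mul_le_mul_of_nonneg_left (le_abs_self _) (z.2.1 a)
      _ ≤ _ := mul_le_of_le_one_left (abs_nonneg _) hz1

/-- The weights `∏ i, k i c (c i)` of a causal family of transition kernels form a probability
distribution on paths, and if the conditional expectation of the reward `r` is at most `u` at
each stage, then the expected total reward is at most `n * u`. -/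
theorem sum_prod_causal_kernel {C : Type*} [Fintype C] [Nonempty C] (r : C → ℝ) (u : ℝ) {n : ℕ}
    (k : Fin n → (Fin n → C) → C → ℝ) (nonneg : ∀ i c x, 0 ≤ k i c x)
    (sum_one : ∀ i c, ∑ x, k i c x = 1)
    (causal : ∀ i c c', (∀ j < i, c j = c' j) → k i c = k i c')
    (reward : ∀ i c, ∑ x, k i c x * r x ≤ u) :
    ∑ c, ∏ i, k i c (c i) = 1 ∧ ∑ c, (∏ i, k i c (c i)) * ∑ i, r (c i) ≤ n * u := by
  induction n with
  | zero => simp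
  | succ n ih =>
    let c₀ : Fin (n + 1) → C := fun _ => Classical.arbitrary C
    let k' (x : C) : Fin n → (Fin n → C) → C → ℝ := fun i c => k i.succ (Fin.cons x c)
    have hk' (x : C) := ih (k' x) (fun _ _ _ => nonneg _ _ _) (fun _ _ => sum_one _ _)
      (fun i c c' h => causal _ _ _ fun j => by
        refine Fin.cases (fun _ => rfl) (fun j hj => ?_) j
        simpa using h j (Fin.succ_lt_succ_iff.mp hj))
      (fun _ _ => reward _ _)
    have hfirst (c) : k 0 c = k 0 c₀ := causal _ _ _ fun j hj => absurd hj (Fin.not_lt_zero j)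
    have hsplit (F : (Fin (n + 1) → C) → ℝ) :
        ∑ c, F c = ∑ x, ∑ c : Fin n → C, F (Fin.cons x c) := by
      rw [← (Fin.consEquiv fun _ => C).sum_comp, Fintype.sum_prod_type]
      rfl
    have hweight (x : C) (c : Fin n → C) :
        ∏ i, k i (Fin.cons x c) ((Fin.cons x c : Fin (n + 1) → C) i) =
          k 0 c₀ x * ∏ i, k' x i c (c i) := by
      rw [Fin.prod_univ_succ, hfirst]
      simp [k']
    constructor
    · simp only [hsplit, hweight, ← mul_sum, (hk' _).1, mul_one, sum_one]
    · simp only [hsplit, hweight, Fin.sum_univ_succ, Fin.cons_zero, Fin.cons_succ]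
      calc ∑ x, ∑ c : Fin n → C, k 0 c₀ x * (∏ i, k' x i c (c i)) * (r x + ∑ i, r (c i))
          = ∑ x, k 0 c₀ x * (r x * ∑ c : Fin n → C, ∏ i, k' x i c (c i) +
              ∑ c : Fin n → C, (∏ i, k' x i c (c i)) * ∑ i, r (c i)) := by
            refine sum_congr rfl fun x _ => ?_
            simp only [mul_add, mul_sum, sum_add_distrib]
            congr 1
            · congr! 1; ring
            · congr! 2; ring
        _ ≤ ∑ x, k 0 c₀ x * (r x + n * u) := by
            gcongr with x
            · exact nonneg _ _ _
            · rw [(hk' x).1, mul_one]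
            · exact (hk' x).2
        _ = ∑ x, k 0 c₀ x * r x + n * u := by
            simp only [mul_add, sum_add_distrib, ← sum_mul, sum_one, one_mul]
        _ ≤ ((n + 1 : ℕ) : ℝ) * u := by
            push_cast
            linarith [reward 0 c₀]

/-- The behavioral strategy that plays the mixed action `y` at every stage. -/
def BehavStrategy.const {A B SI Act : Type*} [Fintype A] [Fintype B] [Fintype Act] (n : ℕ)
    (y : Act → ℝ) (hy : y ∈ stdSimplex ℝ Act) : BehavStrategy A B SI Act n where
  prob _ _ _ _ := y
  nonneg _ _ _ _ := hy.1
  sum_one _ _ _ _ := hy.2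
  causal _ _ _ _ _ _ _ _ := rfl

/-- The conditional probability of the play `(a, b)` when Alice has no side information and Bob
plays the mixed action `y` at every stage. -/
def playWeight {A B : Type*} [Fintype A] [Fintype B] {n : ℕ} (α : BehavStrategy A B Unit A n)
    (y : B → ℝ) (a : Fin n → A) (b : Fin n → B) : ℝ :=
  ∏ i, α.prob i a b () (a i) * y (b i)

theorem playWeight_nonneg {A B : Type*} [Fintype A] [Fintype B] {n : ℕ}
    (α : BehavStrategy A B Unit A n) {y : B → ℝ} (hy : y ∈ stdSimplex ℝ B)
    (a : Fin n → A) (b : Fin n → B) : 0 ≤ playWeight α y a b :=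
  prod_nonneg fun _ _ => mul_nonneg (α.nonneg _ _ _ _ _) (hy.1 _)

/-- If the mixed action `y` holds every reply in the one-stage game `G` to at most `u`, then playing
it at every stage holds the expected total payoff to at most `n * u`. -/
theorem sum_playWeight {A B : Type*} [Fintype A] [Fintype B] [Nonempty A] [Nonempty B] {n : ℕ}
    (α : BehavStrategy A B Unit A n) {y : B → ℝ} (hy : y ∈ stdSimplex ℝ B) (G : A → B → ℝ) (u : ℝ)
    (hu : ∀ a, ∑ b, y b * G a b ≤ u) :
    ∑ a, ∑ b, playWeight α y a b = 1 ∧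
      ∑ a, ∑ b, playWeight α y a b * ∑ i, G (a i) (b i) ≤ n * u := by
  have key := sum_prod_causal_kernel (n := n) (fun x : A × B => G x.1 x.2) u
    (fun i c x => α.prob i (fun j => (c j).1) (fun j => (c j).2) () x.1 * y x.2)
    (fun i c x => mul_nonneg (α.nonneg _ _ _ _ _) (hy.1 _))
    (fun i c => by
      rw [Fintype.sum_prod_type]
      simp only [← mul_sum, hy.2, mul_one, α.sum_one])
    (fun i c c' h => by
      rw [α.causal i _ (fun j => (c' j).1) _ (fun j => (c' j).2) ()
        (fun j hj => by rw [h j hj]) (fun j hj => by rw [h j hj])])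
    (fun i c => by
      rw [Fintype.sum_prod_type]
      simp only [mul_assoc, ← mul_sum]
      calc _ ≤ ∑ a, α.prob i (fun j => (c j).1) (fun j => (c j).2) () a * u :=
            sum_le_sum fun a _ => mul_le_mul_of_nonneg_left (hu a) (α.nonneg _ _ _ _ _)
        _ = u := by rw [← sum_mul, α.sum_one, one_mul])
  have hsplit (F : (Fin n → A) → (Fin n → B) → ℝ) :
      ∑ a, ∑ b, F a b = ∑ c : Fin n → A × B, F (fun j => (c j).1) fun j => (c j).2 := by
    rw [← Fintype.sum_prod_type', ← (Equiv.arrowProdEquivProdArrow _ _ _).sum_comp]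
    rfl
  simpa only [hsplit, playWeight] using key

/-- Against a mixed action `y` that Bob plays at every stage regardless of the state, Alice cannot
keep `σ_n` above `v` without the one-stage payoff under any prior `q ≤ C * p` being nearly `v`. -/
theorem sub_le_of_const {S A B : Type*} [Fintype S] [Fintype A] [Fintype B]
    [Nonempty A] [Nonempty B] (g : S → A → B → ℝ) (p q : S → ℝ) (hq : ∀ s, 0 ≤ q s)
    (hq1 : ∑ s, q s = 1) {C K v u : ℝ} (hC : ∀ s, q s ≤ C * p s) (hK : 0 ≤ K)
    (hg : ∀ s a b, v - K ≤ g s a b) {y : B → ℝ} (hy : y ∈ stdSimplex ℝ B)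
    (hu : ∀ a, ∑ b, y b * ∑ s, q s * g s a b ≤ u) {n : ℕ} (hn : 0 < n)
    (α : BehavStrategy A B Unit A n) :
    v - K * C * probBelow g p (fun _ => ()) (id : S → S) α (BehavStrategy.const n y hy) v ≤ u := by
  classical
  obtain ⟨hone, htotal⟩ := sum_playWeight α hy (fun a b => ∑ s, q s * g s a b) u hu
  have hn' : (0 : ℝ) < n := Nat.cast_pos.mpr hn
  have hwn := playWeight_nonneg α hy
  set w := playWeight α y
  have hpay (s a b) : v - (if avgPay g s a b < v then K else 0) ≤ avgPay g (n := n) s a b := by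
    split_ifs with h
    · rw [avgPay, le_inv_mul_iff₀ hn']
      simpa using card_nsmul_le_sum univ _ _ fun i _ => hg s (a i) (b i)
    · linarith
  have hprob : probBelow g p (fun _ => ()) (id : S → S) α (BehavStrategy.const n y hy) v =
      ∑ s, ∑ a, ∑ b, if avgPay g s a b < v then p s * w a b else 0 := rfl
  calc v - K * C * probBelow g p (fun _ => ()) (id : S → S) α (BehavStrategy.const n y hy) v
      ≤ v - ∑ s, ∑ a, ∑ b, q s * (w a b * if avgPay g s a b < v then K else 0) := by
        rw [hprob]
        simp only [mul_sum]
        refine sub_le_sub_left (sum_le_sum fun s _ => sum_le_sum fun a _ => sum_le_sum fun b _ => ?_) v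
        split_ifs
        · calc q s * (w a b * K) ≤ C * p s * (w a b * K) :=
                mul_le_mul_of_nonneg_right (hC s) (mul_nonneg (hwn a b) hK)
            _ = K * C * (p s * w a b) := by ring
        · simp
    _ = ∑ s, ∑ a, ∑ b, q s * (w a b * (v - if avgPay g s a b < v then K else 0)) := by
        simp only [mul_sub, sum_sub_distrib]
        simp only [← mul_sum, ← sum_mul, hone, hq1, one_mul]
    _ ≤ ∑ s, ∑ a, ∑ b, q s * (w a b * avgPay g s a b) := by
        gcongr with s _ a _ b
        · exact hq s
        · exact hwn a b
        · exact hpay s a b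
    _ = (n : ℝ)⁻¹ * ∑ a, ∑ b, w a b * ∑ i, ∑ s, q s * g s (a i) (b i) := by
        rw [sum_comm]
        simp only [avgPay, mul_sum]
        refine sum_congr rfl fun a _ => ?_
        rw [sum_comm]
        refine sum_congr rfl fun b _ => ?_
        rw [sum_comm]
        congr! 2
        ring
    _ ≤ u := by rwa [inv_mul_le_iff₀ hn']

/-- A weakly guaranteed value is at most the value of every averaged one-stage game. -/
theorem WeaklyGuarantees.le_uVal {S A B : Type*} [Fintype S] [Fintype A] [Fintype B]
    [Nonempty A] [Nonempty B] {g : S → A → B → ℝ} {p : S → ℝ} (hp : ∀ s, 0 < p s) {v : ℝ}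
    (hv : WeaklyGuarantees g p (fun _ => ()) (id : S → S) v) {q : S → ℝ} (hq : ∀ s, 0 ≤ q s)
    (hq1 : ∑ s, q s = 1) : v ≤ uVal g q := by
  obtain ⟨y, hy, hu⟩ := exists_mixed_le_uVal g q
  obtain ⟨m, hm⟩ := (Set.finite_range fun x : S × A × B => g x.1 x.2.1 x.2.2).bddBelow
  set K := |v - m|
  set C := ∑ s, q s / p s
  have hC (s : S) : q s ≤ C * p s := by
    rw [← div_le_iff₀ (hp s)]
    exact single_le_sum (f := fun s => q s / p s)
      (fun s _ => div_nonneg (hq s) (hp s).le) (mem_univ s)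
  have hC0 : 0 ≤ C := sum_nonneg fun s _ => div_nonneg (hq s) (hp s).le
  have hg (s : S) (a : A) (b : B) : v - K ≤ g s a b := by
    linarith [le_abs_self (v - m), hm ⟨(s, a, b), rfl⟩]
  refine le_of_forall_pos_le_add fun ε hε => ?_
  have hKC : 0 ≤ K * C := mul_nonneg (abs_nonneg _) hC0
  obtain ⟨N, hN⟩ := hv (ε / (K * C + 1)) (by positivity)
  obtain ⟨α, hα⟩ := hN (N + 1) N.lt_succ_self (BehavStrategy.const _ y hy)
  have hbound := sub_le_of_const g p q hq hq1 hC (abs_nonneg _) hg hy hu N.succ_pos α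
  have herr := mul_le_mul_of_nonneg_left hα.le hKC
  have hε' : K * C * (ε / (K * C + 1)) ≤ ε := by
    rw [← mul_div_assoc, div_le_iff₀ (by positivity)]
    nlinarith
  linarith

/-- Alice weakly guarantees every lower bound of the payoffs. -/
theorem weaklyGuarantees_of_le {S SA SB A B : Type*} [Fintype S] [Fintype A] [Fintype B]
    [Nonempty A] (g : S → A → B → ℝ) (p : S → ℝ) (TA : S → SA) (TB : S → SB) {m : ℝ}
    (hm : ∀ s a b, m ≤ g s a b) : WeaklyGuarantees g p TA TB m := by
  classical
  refine fun ε hε => ⟨0, fun n hn β =>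
    ⟨BehavStrategy.const n _ (single_mem_stdSimplex ℝ (Classical.arbitrary A)), ?_⟩⟩
  have hpay (s a b) : ¬ avgPay g (n := n) s a b < m := by
    rw [not_lt, avgPay, le_inv_mul_iff₀ (Nat.cast_pos.mpr hn)]
    simpa using card_nsmul_le_sum univ _ _ fun i _ => hm s (a i) (b i)
  simpa [probBelow, hpay] using hε

/-- `v_sup^w(p, ∅, 𝟙) ≤ inf { u(q) : q a probability distribution on 𝒮 }`. -/
theorem stmt7 {S A B : Type*} [Fintype S] [Fintype A] [Fintype B]
    [Nonempty S] [Nonempty A] [Nonempty B]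
    (g : S → A → B → ℝ) (p : S → ℝ) (hp : ∀ s, 0 < p s) (hp1 : ∑ s, p s = 1) :
    vsupW g p (fun _ : S => ()) (id : S → S) ≤
      ⨅ q : {q : S → ℝ // (∀ s, 0 ≤ q s) ∧ ∑ s, q s = 1}, uVal g q.1 := by
  obtain ⟨m, hm⟩ := (Set.finite_range fun x : S × A × B => g x.1 x.2.1 x.2.2).bddBelow
  have : Nonempty {q : S → ℝ // (∀ s, 0 ≤ q s) ∧ ∑ s, q s = 1} := ⟨⟨p, fun s => (hp s).le, hp1⟩⟩
  exact csSup_le ⟨m, weaklyGuarantees_of_le g p _ _ fun s a b => hm ⟨(s, a, b), rfl⟩⟩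
    fun v hv => le_ciInf fun q => WeaklyGuarantees.le_uVal hp hv q.2.1 q.2.2
end
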